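/- arXiv:0706.3478 — 2 statements merged into one kernel-verified Lean document; each statement's English description precedes it below -/
import Mathlib

section
/- For every integer u ≥ 0 there exists a positive rational number c such that 𝒟̄^{u+1}(a₁·p₂^u·p₃) = c·a_{u+3} in P. -/
/- We model the polynomial ring `P = ℚ[p₂, p₃, …, a₁, a₂, …]` as
`MvPolynomial (ℕ ⊕ ℕ) ℚ`, where `Sum.inl u` represents the variable `p_{u+2}`
(`u ≥ 0`) and `Sum.inr w` represents the variable `a_{w+1}` (`w ≥ 0`). -/

open MvPolynomial

noncomputable section

/-- A bound exceeding all (shifted) variable indices occurring in `p`. -/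
def NP (p : MvPolynomial (ℕ ⊕ ℕ) ℚ) : ℕ := (p.vars.image (Sum.elim id id)).sup id + 1

/-- The operator
`𝒟̄ = (1/2)·∑_{m,n≥2} binom(m+n, n) p_{m+n−1} ∂_{p_m} ∂_{p_n}
      + ∑_{m≥1, n≥2} binom(m+n−1, n) a_{m+n−1} ∂_{a_m} ∂_{p_n}`.
In our indexing, with `u = m−2, v = n−2` in the first sum (so `p_{m+n−1}` is
`Sum.inl (u+v+1)`) and `w = m−1, v = n−2` in the second (so `a_{m+n−1}` is
`Sum.inr (w+v+1)`); the sums are cut off beyond the variables occurring in the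
argument, which loses no nonzero terms. -/
def Dbar (p : MvPolynomial (ℕ ⊕ ℕ) ℚ) : MvPolynomial (ℕ ⊕ ℕ) ℚ :=
  (1/2 : ℚ) •
    (∑ u ∈ Finset.range (NP p), ∑ v ∈ Finset.range (NP p),
      (((u + v + 4).choose (v + 2) : ℚ)) •
        (X (Sum.inl (u + v + 1)) * pderiv (Sum.inl u) (pderiv (Sum.inl v) p))) +
  ∑ w ∈ Finset.range (NP p), ∑ v ∈ Finset.range (NP p),
    (((w + v + 2).choose (v + 2) : ℚ)) •
      (X (Sum.inr (w + v + 1)) * pderiv (Sum.inr w) (pderiv (Sum.inl v) p))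

/-- All coefficients of `p` are nonnegative. -/
def NonnegCoeff {σ : Type*} (p : MvPolynomial σ ℚ) : Prop := ∀ d, 0 ≤ coeff d p

namespace NonnegCoeff

variable {σ : Type*} {p q : MvPolynomial σ ℚ}

lemma add (hp : NonnegCoeff p) (hq : NonnegCoeff q) : NonnegCoeff (p + q) := fun d => by
  rw [coeff_add]
  exact add_nonneg (hp d) (hq d)

lemma sum {ι : Type*} {s : Finset ι} {f : ι → MvPolynomial σ ℚ}
    (h : ∀ i ∈ s, NonnegCoeff (f i)) : NonnegCoeff (∑ i ∈ s, f i) := fun d => by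
  rw [coeff_sum]
  exact Finset.sum_nonneg fun i hi => h i hi d

lemma smul {c : ℚ} (hc : 0 ≤ c) (hp : NonnegCoeff p) : NonnegCoeff (c • p) := fun d => by
  rw [coeff_smul, smul_eq_mul]
  exact mul_nonneg hc (hp d)

lemma mul (hp : NonnegCoeff p) (hq : NonnegCoeff q) : NonnegCoeff (p * q) := fun d => by
  classical
  rw [coeff_mul]
  exact Finset.sum_nonneg fun x _ => mul_nonneg (hp _) (hq _)

lemma X (i : σ) : NonnegCoeff (MvPolynomial.X i) := fun d => by
  classical
  rw [coeff_X]
  split_ifs <;> norm_num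

lemma one : NonnegCoeff (1 : MvPolynomial σ ℚ) := fun d => by
  classical
  rw [coeff_one]
  split_ifs <;> norm_num

lemma pow (hp : NonnegCoeff p) (n : ℕ) : NonnegCoeff (p ^ n) := by
  induction n with
  | zero => simpa using one
  | succ n ih => simpa [pow_succ] using ih.mul hp

lemma pderiv (hp : NonnegCoeff p) (i : σ) : NonnegCoeff (MvPolynomial.pderiv i p) := fun d => by
  rw [coeff_pderiv]
  have := hp (d + Finsupp.single i 1)
  positivity

lemma eval_one_nonneg (hp : NonnegCoeff p) : 0 ≤ eval (fun _ => (1 : ℚ)) p := by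
  rw [eval_eq]
  exact Finset.sum_nonneg fun d _ => by simpa using hp d

lemma eval_one_pos (hp : NonnegCoeff p) (h : p ≠ 0) : 0 < eval (fun _ => (1 : ℚ)) p := by
  obtain ⟨d, hd⟩ := support_nonempty.mpr h
  rw [eval_eq]
  refine Finset.sum_pos' (fun d _ => by simpa using hp d) ⟨d, hd, ?_⟩
  simpa using lt_of_le_of_ne (hp d) (mem_support_iff.mp hd).symm

end NonnegCoeff

lemma coeff_pderiv_ne_zero {σ : Type*} {p : MvPolynomial σ ℚ} {d : σ →₀ ℕ} {i : σ}
    (h : coeff (d + Finsupp.single i 1) p ≠ 0) : coeff d (pderiv i p) ≠ 0 := by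
  rw [coeff_pderiv]
  exact mul_ne_zero h (by positivity)

/-- The grading preserved by `Dbar` up to a shift: the number of `p`-variables, the total
shifted index, and the number of `a`-variables. -/
def grading : ℕ ⊕ ℕ → ℤ × ℤ × ℤ :=
  Sum.elim (fun u => (1, u + 1, 0)) (fun w => (0, w, 1))

lemma IsWeightedHomogeneous.smul {σ M : Type*} [AddCommMonoid M] {w : σ → M} {m : M}
    {p : MvPolynomial σ ℚ} (hp : IsWeightedHomogeneous w p m) (c : ℚ) :
    IsWeightedHomogeneous w (c • p) m := by
  rw [smul_eq_C_mul]
  exact hp.C_mul c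

lemma isWeightedHomogeneous_X_mul_pderiv_pderiv {σ M : Type*} [AddCommGroup M] {w : σ → M}
    {m m' : M} {p : MvPolynomial σ ℚ} (hp : IsWeightedHomogeneous w p m) (i j k : σ)
    (h : w k + (m - w j - w i) = m') :
    IsWeightedHomogeneous w (X k * pderiv i (pderiv j p)) m' := by
  rw [← h]
  exact (isWeightedHomogeneous_X ℚ w k).mul
    ((hp.pderiv (sub_add_cancel _ _)).pderiv (sub_add_cancel _ _))

lemma Dbar_isWeightedHomogeneous {p : MvPolynomial (ℕ ⊕ ℕ) ℚ} {n m a : ℤ}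
    (hp : IsWeightedHomogeneous grading p (n, m, a)) :
    IsWeightedHomogeneous grading (Dbar p) (n - 1, m, a) := by
  refine (IsWeightedHomogeneous.smul (IsWeightedHomogeneous.sum _ _ _ fun u _ =>
    IsWeightedHomogeneous.sum _ _ _ fun v _ => IsWeightedHomogeneous.smul
      (isWeightedHomogeneous_X_mul_pderiv_pderiv hp _ _ _ ?_) _) _).add
    (IsWeightedHomogeneous.sum _ _ _ fun w _ => IsWeightedHomogeneous.sum _ _ _ fun v _ =>
      IsWeightedHomogeneous.smul (isWeightedHomogeneous_X_mul_pderiv_pderiv hp _ _ _ ?_) _)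
  all_goals
    simp only [grading, Sum.elim_inl, Sum.elim_inr, Prod.mk_add_mk, Prod.mk_sub_mk, Prod.mk.injEq]
    push_cast
    refine ⟨?_, ?_, ?_⟩ <;> ring

lemma Dbar_nonnegCoeff {p : MvPolynomial (ℕ ⊕ ℕ) ℚ} (hp : NonnegCoeff p) :
    NonnegCoeff (Dbar p) :=
  (NonnegCoeff.smul (by norm_num) (NonnegCoeff.sum fun _ _ => NonnegCoeff.sum fun _ _ =>
    NonnegCoeff.smul (by positivity) ((NonnegCoeff.X _).mul ((hp.pderiv _).pderiv _)))).add
  (NonnegCoeff.sum fun _ _ => NonnegCoeff.sum fun _ _ =>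
    NonnegCoeff.smul (by positivity) ((NonnegCoeff.X _).mul ((hp.pderiv _).pderiv _)))

lemma lt_NP {p : MvPolynomial (ℕ ⊕ ℕ) ℚ} {i : ℕ ⊕ ℕ} (hi : i ∈ p.vars) :
    Sum.elim id id i < NP p :=
  Nat.lt_succ_of_le (Finset.le_sup (f := id) (Finset.mem_image_of_mem _ hi))

lemma exists_inl_of_weight {d : ℕ ⊕ ℕ →₀ ℕ} (h : (Finsupp.weight grading d).1 ≠ 0) :
    ∃ v, d (Sum.inl v) ≠ 0 := by
  contrapose! h
  rw [Finsupp.weight_apply, Finsupp.sum, Prod.fst_sum]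
  refine Finset.sum_eq_zero fun i _ => ?_
  rcases i with v | w
  · simp [h v]
  · simp [grading]

lemma exists_inr_of_weight {d : ℕ ⊕ ℕ →₀ ℕ} (h : (Finsupp.weight grading d).2.2 ≠ 0) :
    ∃ w, d (Sum.inr w) ≠ 0 := by
  contrapose! h
  rw [Finsupp.weight_apply, Finsupp.sum, Prod.snd_sum, Prod.snd_sum]
  refine Finset.sum_eq_zero fun i _ => ?_
  rcases i with v | w
  · simp [grading]
  · simp [h w]

lemma eq_single_of_weight {d : ℕ ⊕ ℕ →₀ ℕ} {m : ℕ}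
    (h : Finsupp.weight grading d = (0, (m : ℤ), 1)) : d = Finsupp.single (Sum.inr m) 1 := by
  obtain ⟨w, hw⟩ := exists_inr_of_weight (d := d) (by simp [h])
  obtain ⟨e, rfl⟩ : ∃ e, d = e + Finsupp.single (Sum.inr w) 1 :=
    ⟨_, (Finsupp.sub_add_single_one_cancel hw).symm⟩
  have he : Finsupp.weight grading e = (0, (m : ℤ) - w, 0) := by
    rw [map_add, Finsupp.weight_single, one_smul] at h
    rw [eq_sub_of_add_eq h]
    simp [grading]
  have hz : e = 0 := by
    rw [Finsupp.weight_apply, Finsupp.sum] at he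
    have h1 := congrArg Prod.fst he
    have h2 := congrArg (fun x => x.2.2) he
    simp only [Prod.fst_sum, Prod.snd_sum] at h1 h2
    rw [Finset.sum_eq_zero_iff_of_nonneg] at h1 h2
    · ext i
      by_contra hi
      have hi' := Finsupp.mem_support_iff.mpr hi
      rcases i with v | v
      · exact hi (by simpa [grading] using h1 _ hi')
      · exact hi (by simpa [grading] using h2 _ hi')
    all_goals
      rintro (v | v) _ <;> simp [grading]
  subst hz
  have : (m : ℤ) - w = 0 := by simpa using (congrArg (fun x => x.2.1) he).symm
  obtain rfl : m = w := by omega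
  simp

lemma Dbar_ne_zero {p : MvPolynomial (ℕ ⊕ ℕ) ℚ} {n m : ℤ} (hp : NonnegCoeff p) (h0 : p ≠ 0)
    (hn : n ≠ 0) (hh : IsWeightedHomogeneous grading p (n, m, 1)) : Dbar p ≠ 0 := by
  obtain ⟨d, hd⟩ := support_nonempty.mpr h0
  have hwt := hh (mem_support_iff.mp hd)
  obtain ⟨v, hv⟩ := exists_inl_of_weight (d := d) (by simpa [hwt] using hn)
  obtain ⟨w, hw⟩ := exists_inr_of_weight (d := d) (by simp [hwt])
  have hvN : v < NP p :=
    lt_NP (i := Sum.inl v) ((mem_vars_iff_mem_support _).mpr ⟨d, hd, by simpa using hv⟩)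
  have hwN : w < NP p :=
    lt_NP (i := Sum.inr w) ((mem_vars_iff_mem_support _).mpr ⟨d, hd, by simpa using hw⟩)
  obtain ⟨e, rfl⟩ : ∃ e, d = e + Finsupp.single (Sum.inl v) 1 :=
    ⟨_, (Finsupp.sub_add_single_one_cancel hv).symm⟩
  have hwe : e (Sum.inr w) ≠ 0 := by simpa using hw
  obtain ⟨f, rfl⟩ : ∃ f, e = f + Finsupp.single (Sum.inr w) 1 :=
    ⟨_, (Finsupp.sub_add_single_one_cancel hwe).symm⟩
  have hne : pderiv (Sum.inr w) (pderiv (Sum.inl v) p) ≠ 0 := ne_zero_iff.mpr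
    ⟨f, coeff_pderiv_ne_zero (coeff_pderiv_ne_zero (mem_support_iff.mp hd))⟩
  have hterm (i j k : ℕ ⊕ ℕ) (c : ℕ) :
      NonnegCoeff ((c : ℚ) • (X k * pderiv i (pderiv j p))) :=
    NonnegCoeff.smul (by positivity) ((NonnegCoeff.X _).mul ((hp.pderiv _).pderiv _))
  suffices 0 < eval (fun _ => (1 : ℚ)) (Dbar p) by
    rintro h
    simp [h] at this
  rw [Dbar, map_add]
  refine add_pos_of_nonneg_of_pos (NonnegCoeff.eval_one_nonneg <| NonnegCoeff.smul (by norm_num) <|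
    NonnegCoeff.sum fun _ _ => NonnegCoeff.sum fun _ _ => hterm _ _ _ _) ?_
  rw [map_sum]
  refine Finset.sum_pos' (fun _ _ => (NonnegCoeff.sum fun _ _ => hterm _ _ _ _).eval_one_nonneg)
    ⟨w, Finset.mem_range.mpr hwN, ?_⟩
  rw [map_sum]
  refine Finset.sum_pos' (fun _ _ => (hterm _ _ _ _).eval_one_nonneg)
    ⟨v, Finset.mem_range.mpr hvN, (hterm _ _ _ _).eval_one_pos ?_⟩
  refine smul_ne_zero ?_ (mul_ne_zero (X_ne_zero _) hne)
  exact_mod_cast (Nat.choose_pos (by omega)).ne'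

lemma exists_Dbar_iterate_eq {m : ℕ} (n : ℕ) {p : MvPolynomial (ℕ ⊕ ℕ) ℚ} (hp : NonnegCoeff p)
    (h0 : p ≠ 0) (hh : IsWeightedHomogeneous grading p ((n : ℤ), (m : ℤ), 1)) :
    ∃ c : ℚ, 0 < c ∧ Dbar^[n] p = c • X (Sum.inr m) := by
  induction n generalizing p with
  | zero =>
    have h := hh.eq_monomial_of_unique_weight (d₀ := Finsupp.single (Sum.inr m) 1)
      fun d hd => eq_single_of_weight (by simpa using hd)
    have hpX : p = coeff (Finsupp.single (Sum.inr m) 1) p • X (Sum.inr m) := by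
      rw [X, smul_monomial, smul_eq_mul, mul_one]
      exact h
    refine ⟨_, lt_of_le_of_ne (hp _) fun hc => h0 ?_, hpX⟩
    rw [hpX, ← hc, zero_smul]
  | succ n ih =>
    exact ih (Dbar_nonnegCoeff hp) (Dbar_ne_zero hp h0 (by positivity) hh)
      (by simpa using Dbar_isWeightedHomogeneous hh)

/-- for every `u ≥ 0` there is a positive rational `c` with
`𝒟̄^{u+1}(a₁·p₂^u·p₃) = c·a_{u+3}` in `P`.  Here `a₁ = X (Sum.inr 0)`,
`p₂ = X (Sum.inl 0)`, `p₃ = X (Sum.inl 1)` and `a_{u+3} = X (Sum.inr (u+2))`. -/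
theorem stmt16 (u : ℕ) :
    ∃ c : ℚ, 0 < c ∧
      Dbar^[u + 1] (X (Sum.inr 0) * X (Sum.inl 0) ^ u * X (Sum.inl 1)) =
        c • X (Sum.inr (u + 2)) := by
  refine exists_Dbar_iterate_eq (u + 1)
    (((NonnegCoeff.X _).mul ((NonnegCoeff.X _).pow u)).mul (NonnegCoeff.X _))
    (mul_ne_zero (mul_ne_zero (X_ne_zero _) (pow_ne_zero _ (X_ne_zero _))) (X_ne_zero _)) ?_
  convert ((isWeightedHomogeneous_X ℚ grading (Sum.inr 0)).mul
    ((isWeightedHomogeneous_X ℚ grading (Sum.inl 0)).pow u)).mul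
    (isWeightedHomogeneous_X ℚ grading (Sum.inl 1)) using 1
  simp [grading]
end
end

section
/- Let j ≥ 1 and let i be an integer with 2i − j ≤ g. Let Φ_{i−1} ⊆ R be the ℚ[x₁]-submodule generated by the elements of Mon_{(j)} of codimension at most i − 1, i.e. the ℚ-span of all x₁^a·m with a ≥ 0 and m ∈ Mon_{(j)} of codimension ≤ i − 1. Then for every y ∈ M^i_{(j)} one has: y ∈ I + Φ_{i−1} if and only if y ∈ 𝒟^{g−2i+j+1}(M^{g−i+j+1}_{(j)}). -/
/- We model `R = ℚ[x₁, x₂, …]` as `MvPolynomial ℕ ℚ`, the variable of index `v`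
representing `x_{v+1}` (so `x_k = X (k-1)` for `k ≥ 1`). -/

open MvPolynomial

noncomputable section

/-- Codimension grading: `codim x_{v+1} = v + 1`. -/
def codimW (d : ℕ →₀ ℕ) : ℕ := d.sum fun v e => (v + 1) * e

/-- Level grading: `ℓ(x_{v+1}) = v`. -/
def levelW (d : ℕ →₀ ℕ) : ℕ := d.sum fun v e => v * e

/-- `R^i_{(j)}`: the ℚ-span of the monomials of codimension `i` and level `j`. -/
def Rij (i j : ℕ) : Submodule ℚ (MvPolynomial ℕ ℚ) :=
  Submodule.span ℚ
    { p | ∃ d : ℕ →₀ ℕ, codimW d = i ∧ levelW d = j ∧ p = monomial d (1 : ℚ) }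

/-- Polishchuk's operator
`𝒟 = -g ∂₁ + (1/2) ∑_{m,n ≥ 1} binom(m+n, n) x_{m+n-1} ∂_m ∂_n`; in our indexing,
with `a = m−1`, `b = n−1`, the second term is
`(1/2) ∑_{a,b ≥ 0} binom(a+b+2, b+1) X(a+b) ∂_{X a} ∂_{X b}`.  On a given polynomial
`p` only the finitely many terms with both variables occurring in `p` are nonzero, so
the sum may be cut off beyond all variable indices of `p`. -/
def Dop (g : ℕ) (p : MvPolynomial ℕ ℚ) : MvPolynomial ℕ ℚ :=
  -(g : ℚ) • pderiv 0 p +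
    (1/2 : ℚ) •
      ∑ a ∈ Finset.range (p.vars.sup id + 1), ∑ b ∈ Finset.range (p.vars.sup id + 1),
        (((a + b + 2).choose (b + 1) : ℚ)) • (X (a + b) * pderiv a (pderiv b p))

/-- `R^{>g}`: span of monomials of codimension `> g`. -/
def Rgt (g : ℕ) : Submodule ℚ (MvPolynomial ℕ ℚ) :=
  Submodule.span ℚ { p | ∃ d : ℕ →₀ ℕ, g < codimW d ∧ p = monomial d (1 : ℚ) }

/-- `Fil¹R^g`: span of monomials of codimension `g` and level `≥ 1`. -/
def Fil1Rg (g : ℕ) : Submodule ℚ (MvPolynomial ℕ ℚ) :=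
  Submodule.span ℚ
    { p | ∃ d : ℕ →₀ ℕ, codimW d = g ∧ 1 ≤ levelW d ∧ p = monomial d (1 : ℚ) }

/-- Polishchuk's ideal of universal relations `I = R^{>g} + ∑_{n ≥ 0} 𝒟ⁿ(Fil¹R^g)`. -/
def Ipol (g : ℕ) : Submodule ℚ (MvPolynomial ℕ ℚ) :=
  Rgt g ⊔ ⨆ n : ℕ, Submodule.span ℚ ((Dop g)^[n] '' (Fil1Rg g : Set (MvPolynomial ℕ ℚ)))

/-- `M^i_{(j)}`: span of monomials in `x₂, x₃, …` (no `x₁`, i.e. exponent of the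
variable of index `0` is zero) of codimension `i` and level `j`. -/
def Mij (i j : ℕ) : Submodule ℚ (MvPolynomial ℕ ℚ) :=
  Submodule.span ℚ
    { p | ∃ d : ℕ →₀ ℕ, d 0 = 0 ∧ codimW d = i ∧ levelW d = j ∧ p = monomial d (1 : ℚ) }

/-- `Φ_c`: the `ℚ[x₁]`-submodule generated by the monomials in `x₂, x₃, …` of level `j`
and codimension at most `c`, i.e. the ℚ-span of all `x₁^a · m` with `a ≥ 0` and
`m ∈ Mon_{(j)}` of codimension `≤ c`. -/
def PhiSub (c j : ℕ) : Submodule ℚ (MvPolynomial ℕ ℚ) :=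
  Submodule.span ℚ
    { p | ∃ (a : ℕ) (d : ℕ →₀ ℕ),
        d 0 = 0 ∧ codimW d ≤ c ∧ levelW d = j ∧ p = X 0 ^ a * monomial d (1 : ℚ) }

/-! ### `Dop` as a linear map -/

/-- The operator of `Dop` with all sums cut off at a fixed bound `K`. -/
def dopTrunc (g K : ℕ) : MvPolynomial ℕ ℚ →ₗ[ℚ] MvPolynomial ℕ ℚ :=
  -(g : ℚ) • (pderiv 0).toLinearMap +
    (1/2 : ℚ) •
      ∑ a ∈ Finset.range K, ∑ b ∈ Finset.range K,
        (((a + b + 2).choose (b + 1) : ℚ)) •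
          (LinearMap.mulLeft ℚ (X (a + b)) ∘ₗ (pderiv a).toLinearMap ∘ₗ (pderiv b).toLinearMap)

lemma dopTrunc_apply (g K : ℕ) (p : MvPolynomial ℕ ℚ) :
    dopTrunc g K p = -(g : ℚ) • pderiv 0 p + (1/2 : ℚ) •
      ∑ a ∈ Finset.range K, ∑ b ∈ Finset.range K,
        (((a + b + 2).choose (b + 1) : ℚ)) • (X (a + b) * pderiv a (pderiv b p)) := by
  simp [dopTrunc, LinearMap.sum_apply]

lemma pderiv_eq_zero_of_sup_vars_lt {p : MvPolynomial ℕ ℚ} {a : ℕ} (h : p.vars.sup id < a) :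
    pderiv a p = 0 :=
  pderiv_eq_zero_of_notMem_vars fun ha =>
    absurd (Finset.le_sup (f := id) ha : a ≤ _) (not_le.mpr h)

lemma pderiv_pderiv_comm (a b : ℕ) (p : MvPolynomial ℕ ℚ) :
    pderiv a (pderiv b p) = pderiv b (pderiv a p) := by
  ext m
  by_cases h : a = b
  · rw [h]
  · simp only [coeff_pderiv, add_right_comm m (Finsupp.single a 1), Finsupp.add_apply,
      Finsupp.single_apply, h, Ne.symm h, if_false, add_zero]
    ring

lemma Dop_eq_dopTrunc (g : ℕ) {K : ℕ} {p : MvPolynomial ℕ ℚ} (h : p.vars.sup id < K) :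
    Dop g p = dopTrunc g K p := by
  rw [dopTrunc_apply, Dop]
  congr 2
  have hsub : Finset.range (p.vars.sup id + 1) ⊆ Finset.range K :=
    Finset.range_subset_range.mpr h
  have hz {a : ℕ} (ha : a ∉ Finset.range (p.vars.sup id + 1)) : pderiv a p = 0 :=
    pderiv_eq_zero_of_sup_vars_lt (by rw [Finset.mem_range] at ha; omega)
  rw [← Finset.sum_subset hsub]
  · refine Finset.sum_congr rfl fun a _ => Finset.sum_subset hsub fun b _ hb => ?_
    simp [hz hb]
  · intro a _ ha
    refine Finset.sum_eq_zero fun b _ => ?_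
    simp [pderiv_pderiv_comm a b, hz ha]

/-- `Dop` as a `ℚ`-linear map. -/
def dopL (g : ℕ) : MvPolynomial ℕ ℚ →ₗ[ℚ] MvPolynomial ℕ ℚ where
  toFun := Dop g
  map_add' p q := by
    have hp : p.vars.sup id < p.vars.sup id + q.vars.sup id + (p + q).vars.sup id + 1 := by omega
    have hq : q.vars.sup id < p.vars.sup id + q.vars.sup id + (p + q).vars.sup id + 1 := by omega
    have hpq : (p + q).vars.sup id <
      p.vars.sup id + q.vars.sup id + (p + q).vars.sup id + 1 := by omega
    rw [Dop_eq_dopTrunc g hp, Dop_eq_dopTrunc g hq, Dop_eq_dopTrunc g hpq, map_add]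
  map_smul' c p := by
    have hp : p.vars.sup id < p.vars.sup id + (c • p).vars.sup id + 1 := by omega
    have hc : (c • p).vars.sup id < p.vars.sup id + (c • p).vars.sup id + 1 := by omega
    rw [Dop_eq_dopTrunc g hp, Dop_eq_dopTrunc g hc, map_smul, RingHom.id_apply]

lemma dopL_eq_dopTrunc (g : ℕ) {K : ℕ} {p : MvPolynomial ℕ ℚ} (h : p.vars.sup id < K) :
    dopL g p = dopTrunc g K p :=
  Dop_eq_dopTrunc g h

lemma dopL_pow_apply (g n : ℕ) (p : MvPolynomial ℕ ℚ) : (dopL g ^ n) p = (Dop g)^[n] p :=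
  Module.End.pow_apply _ _ _

/-! ### Gradings -/

lemma codimW_add (d e : ℕ →₀ ℕ) : codimW (d + e) = codimW d + codimW e :=
  Finsupp.sum_add_index' (by simp) (by intros; ring)

lemma levelW_add (d e : ℕ →₀ ℕ) : levelW (d + e) = levelW d + levelW e :=
  Finsupp.sum_add_index' (by simp) (by intros; ring)

@[simp] lemma codimW_single (v e : ℕ) : codimW (Finsupp.single v e) = (v + 1) * e := by
  simp [codimW]

@[simp] lemma levelW_single (v e : ℕ) : levelW (Finsupp.single v e) = v * e := by
  simp [levelW]

lemma codimW_eq_levelW_add (d : ℕ →₀ ℕ) : codimW d = levelW d + d.sum fun _ e => e := by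
  simp only [codimW, levelW, ← Finsupp.sum_add]
  exact Finsupp.sum_congr fun v _ => by ring

lemma levelW_lt_codimW {d : ℕ →₀ ℕ} (h : levelW d ≠ 0) : levelW d < codimW d := by
  rw [codimW_eq_levelW_add]
  have hd : d ≠ 0 := by rintro rfl; simp [levelW] at h
  have : (d.sum fun _ e => e) ≠ 0 := by
    intro h0
    apply hd
    ext v
    by_contra hv
    exact hv (Finset.sum_eq_zero_iff.mp h0 v (Finsupp.mem_support_iff.mpr hv))
  omega

lemma eq_erase_zero_add (d : ℕ →₀ ℕ) : d = d.erase 0 + Finsupp.single 0 (d 0) :=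
  (Finsupp.erase_add_single 0 d).symm

lemma span_monomial_eq_restrictSupport (P : (ℕ →₀ ℕ) → Prop) :
    Submodule.span ℚ {p | ∃ d, P d ∧ p = monomial d (1 : ℚ)} = restrictSupport ℚ {d | P d} := by
  rw [restrictSupport_eq_span]
  congr 1
  ext p
  simp [eq_comm]

lemma Mij_eq (i j : ℕ) :
    Mij i j = restrictSupport ℚ {d | d 0 = 0 ∧ codimW d = i ∧ levelW d = j} := by
  rw [← span_monomial_eq_restrictSupport]
  simp only [Mij, and_assoc]

lemma Fil1Rg_eq (g : ℕ) :
    Fil1Rg g = restrictSupport ℚ {d | codimW d = g ∧ 1 ≤ levelW d} := by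
  rw [← span_monomial_eq_restrictSupport]
  simp only [Fil1Rg, and_assoc]

lemma restrictSupport_le_iff {S : Set (ℕ →₀ ℕ)} {W : Submodule ℚ (MvPolynomial ℕ ℚ)} :
    restrictSupport ℚ S ≤ W ↔ ∀ d ∈ S, monomial d (1 : ℚ) ∈ W := by
  rw [restrictSupport_eq_span, Submodule.span_le, Set.image_subset_iff]
  rfl

lemma monomial_mem_restrictSupport_of_mem {S : Set (ℕ →₀ ℕ)} {d : ℕ →₀ ℕ} (h : d ∈ S) (c : ℚ) :
    monomial d c ∈ restrictSupport ℚ S :=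
  (monomial_mem_restrictSupport ℚ).mpr (Or.inl h)

lemma monomial_mem_restrictSupport_setOf {P : (ℕ →₀ ℕ) → Prop} {d : ℕ →₀ ℕ} (h : P d) (c : ℚ) :
    monomial d c ∈ restrictSupport ℚ {d | P d} :=
  monomial_mem_restrictSupport_of_mem h c

lemma pderiv_monomial_eq (a : ℕ) (d : ℕ →₀ ℕ) (c : ℚ) :
    pderiv a (monomial d c) = 0 ∨
      ∃ e c', d = e + Finsupp.single a 1 ∧ pderiv a (monomial d c) = monomial e c' := by
  rw [pderiv_monomial]
  by_cases h : d a = 0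
  · simp [h]
  · exact Or.inr ⟨_, _, (Finsupp.sub_add_single_one_cancel h).symm, rfl⟩

lemma dopL_monomial_mem (g : ℕ) (d : ℕ →₀ ℕ) :
    dopL g (monomial d 1) ∈ restrictSupport ℚ
      {e | codimW e + 1 = codimW d ∧ levelW e = levelW d ∧ (d 0 = 0 → e 0 = 0)} := by
  rw [dopL_eq_dopTrunc g (Nat.lt_succ_self _), dopTrunc_apply]
  refine add_mem (Submodule.smul_mem _ _ ?_) (Submodule.smul_mem _ _ (sum_mem fun a _ =>
    sum_mem fun b _ => Submodule.smul_mem _ _ ?_))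
  · obtain h | ⟨e, c, rfl, h⟩ := pderiv_monomial_eq 0 d 1
    · simp [h]
    · rw [h]
      refine monomial_mem_restrictSupport_setOf ⟨?_, ?_, ?_⟩ _ <;>
        simp [codimW_add, levelW_add]
  · obtain h | ⟨e, c, rfl, h⟩ := pderiv_monomial_eq b d 1
    · simp [h]
    rw [h]
    obtain h | ⟨f, c', rfl, h⟩ := pderiv_monomial_eq a e c
    · simp [h]
    rw [h, X, monomial_mul]
    refine monomial_mem_restrictSupport_setOf ⟨?_, ?_, ?_⟩ _
    · simp only [codimW_add, codimW_single]; ring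
    · simp only [levelW_add, levelW_single]; ring
    · simp only [Finsupp.add_apply, Finsupp.single_apply]
      grind

lemma dopL_mem_restrictSupport (g : ℕ) {S T : Set (ℕ →₀ ℕ)}
    (h : ∀ d ∈ S, ∀ e, codimW e + 1 = codimW d → levelW e = levelW d →
      (d 0 = 0 → e 0 = 0) → e ∈ T) {p : MvPolynomial ℕ ℚ} (hp : p ∈ restrictSupport ℚ S) :
    dopL g p ∈ restrictSupport ℚ T := by
  suffices restrictSupport ℚ S ≤ (restrictSupport ℚ T).comap (dopL g) from this hp
  exact restrictSupport_le_iff.mpr fun d hd =>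
    restrictSupport_mono _ (fun e he => h d hd e he.1 he.2.1 he.2.2) (dopL_monomial_mem g d)

lemma dopL_pow_mem_restrictSupport (g n : ℕ) {S T : Set (ℕ →₀ ℕ)}
    (h : ∀ d ∈ S, ∀ e, codimW e + n = codimW d → levelW e = levelW d →
      (d 0 = 0 → e 0 = 0) → e ∈ T) {p : MvPolynomial ℕ ℚ} (hp : p ∈ restrictSupport ℚ S) :
    (dopL g ^ n) p ∈ restrictSupport ℚ T := by
  induction n generalizing T with
  | zero => exact restrictSupport_mono _ (fun d hd => h d hd d rfl rfl id) hp
  | succ n ih =>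
    rw [pow_succ', Module.End.mul_apply]
    refine dopL_mem_restrictSupport g (S := {e | ∃ d ∈ S, codimW e + n = codimW d ∧
      levelW e = levelW d ∧ (d 0 = 0 → e 0 = 0)}) ?_
      (ih fun d hd e h1 h2 h3 => ⟨d, hd, h1, h2, h3⟩)
    rintro e ⟨d, hd, h1, h2, h3⟩ f h1' h2' h3'
    exact h d hd f (by omega) (by omega) fun h0 => h3' (h3 h0)

/-! ### The `sl₂`-relations -/

/-- The polynomials on which `[𝒟, x₁]` acts by the scalar `t`. -/
def weightSpace (g : ℕ) (t : ℚ) : Submodule ℚ (MvPolynomial ℕ ℚ) :=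
  restrictSupport ℚ {d | 2 * (codimW d : ℚ) - levelW d - g = t}

lemma dopL_mem_weightSpace {g : ℕ} {t : ℚ} {p : MvPolynomial ℕ ℚ} (hp : p ∈ weightSpace g t) :
    dopL g p ∈ weightSpace g (t - 2) := by
  refine dopL_mem_restrictSupport g (fun d hd e h1 h2 _ => ?_) hp
  simp only [Set.mem_ofPred_eq] at hd ⊢
  rw [← hd, ← h1, h2]
  push_cast
  ring

lemma X_zero_mul_mem_weightSpace {g : ℕ} {t : ℚ} {p : MvPolynomial ℕ ℚ}
    (hp : p ∈ weightSpace g t) : X 0 * p ∈ weightSpace g (t + 2) := by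
  suffices weightSpace g t ≤ (weightSpace g (t + 2)).comap (LinearMap.mulLeft ℚ (X 0)) from this hp
  refine restrictSupport_le_iff.mpr fun d hd => ?_
  simp only [Set.mem_ofPred_eq] at hd
  rw [Submodule.mem_comap, LinearMap.mulLeft_apply, X, monomial_mul]
  refine monomial_mem_restrictSupport_of_mem ?_ _
  simp only [Set.mem_ofPred_eq, codimW_add, levelW_add, codimW_single, levelW_single, ← hd]
  push_cast
  ring

lemma pderiv_pderiv_X_zero_mul (a b : ℕ) (p : MvPolynomial ℕ ℚ) :
    pderiv a (pderiv b (X 0 * p)) =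
      (if b = 0 then pderiv a p else 0) + (if a = 0 then pderiv b p else 0) +
        X 0 * pderiv a (pderiv b p) := by
  by_cases ha : a = 0 <;> by_cases hb : b = 0 <;> simp [ha, hb] <;> ring

lemma dopTrunc_X_zero_mul (g K : ℕ) (p : MvPolynomial ℕ ℚ) :
    dopTrunc g (K + 1) (X 0 * p) = X 0 * dopTrunc g (K + 1) p +
      (-(g : ℚ) • p + ∑ b ∈ Finset.range (K + 1), ((b : ℚ) + 2) • (X b * pderiv b p)) := by
  have h0 : (0 : ℕ) ∈ Finset.range (K + 1) := by simp
  simp only [dopTrunc_apply, pderiv_pderiv_X_zero_mul, mul_add, smul_add, Finset.sum_add_distrib,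
    mul_ite, mul_zero, smul_ite, smul_zero, Finset.sum_ite_eq', h0, if_true]
  have h1 : ∑ a ∈ Finset.range (K + 1), ∑ b ∈ Finset.range (K + 1),
      (if a = 0 then (((a + b + 2).choose (b + 1) : ℕ) : ℚ) • (X (a + b) * pderiv b p) else 0) =
      ∑ b ∈ Finset.range (K + 1), ((b : ℚ) + 2) • (X b * pderiv b p) := by
    rw [Finset.sum_eq_single_of_mem 0 h0 (by intro a _ ha; simp [ha])]
    refine Finset.sum_congr rfl fun b _ => ?_
    rw [if_pos rfl, zero_add, Nat.choose_succ_self_right]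
    push_cast
    ring_nf
  have h2 : ∑ a ∈ Finset.range (K + 1),
      (((a + 0 + 2).choose (0 + 1) : ℕ) : ℚ) • (X (a + 0) * pderiv a p) =
      ∑ b ∈ Finset.range (K + 1), ((b : ℚ) + 2) • (X b * pderiv b p) := by
    refine Finset.sum_congr rfl fun b _ => ?_
    simp
  rw [h1, h2]
  have h3 : X 0 * ∑ a ∈ Finset.range (K + 1), ∑ b ∈ Finset.range (K + 1),
      (((a + b + 2).choose (b + 1) : ℕ) : ℚ) • (X (a + b) * pderiv a (pderiv b p)) =
      ∑ a ∈ Finset.range (K + 1), ∑ b ∈ Finset.range (K + 1),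
      (((a + b + 2).choose (b + 1) : ℕ) : ℚ) • (X (a + b) * (X 0 * pderiv a (pderiv b p))) := by
    simp only [Finset.mul_sum, mul_smul_comm, mul_left_comm]
  simp only [mul_smul_comm, h3, pderiv_mul, pderiv_X_self, one_mul, smul_add]
  module

lemma sum_X_mul_pderiv_monomial {K : ℕ} {d : ℕ →₀ ℕ} (hK : d.support ⊆ Finset.range K) :
    ∑ b ∈ Finset.range K, ((b : ℚ) + 2) • (X b * pderiv b (monomial d (1 : ℚ))) =
      (2 * (codimW d : ℚ) - levelW d) • monomial d 1 := by
  have hc : codimW d = ∑ b ∈ Finset.range K, (b + 1) * d b :=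
    Finsupp.sum_of_support_subset _ hK _ (by simp)
  have hl : levelW d = ∑ b ∈ Finset.range K, b * d b :=
    Finsupp.sum_of_support_subset _ hK _ (by simp)
  rw [hc, hl]
  push_cast
  rw [Finset.mul_sum, ← Finset.sum_sub_distrib, Finset.sum_smul]
  refine Finset.sum_congr rfl fun b _ => ?_
  rw [X_mul_pderiv_monomial, ← Nat.cast_smul_eq_nsmul ℚ, smul_smul]
  ring_nf

lemma dopL_X_zero_mul {g : ℕ} {t : ℚ} {p : MvPolynomial ℕ ℚ} (hp : p ∈ weightSpace g t) :
    dopL g (X 0 * p) = X 0 * dopL g p + t • p := by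
  suffices weightSpace g t ≤ LinearMap.ker (dopL g ∘ₗ LinearMap.mulLeft ℚ (X 0) -
      LinearMap.mulLeft ℚ (X 0) ∘ₗ dopL g - t • LinearMap.id) by
    have := this hp
    simp only [LinearMap.mem_ker, LinearMap.sub_apply, LinearMap.comp_apply,
      LinearMap.mulLeft_apply, LinearMap.smul_apply, LinearMap.id_apply] at this
    rw [sub_sub, sub_eq_zero] at this
    exact this
  refine restrictSupport_le_iff.mpr fun d hd => ?_
  simp only [Set.mem_ofPred_eq] at hd
  simp only [LinearMap.mem_ker, LinearMap.sub_apply, LinearMap.comp_apply,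
    LinearMap.mulLeft_apply, LinearMap.smul_apply, LinearMap.id_apply]
  set K := (X 0 * monomial d (1 : ℚ)).vars.sup id + (monomial d (1 : ℚ)).vars.sup id with hK
  rw [dopL_eq_dopTrunc g (show _ < K + 1 by omega),
    dopL_eq_dopTrunc g (p := monomial d (1 : ℚ)) (show _ < K + 1 by omega),
    dopTrunc_X_zero_mul, sum_X_mul_pderiv_monomial, ← hd]
  · module
  · intro v hv
    rw [← vars_monomial (R := ℚ) one_ne_zero] at hv
    have : v ≤ _ := Finset.le_sup (f := id) hv
    rw [Finset.mem_range]
    omega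

lemma X_zero_pow_mul_mem_weightSpace {g : ℕ} {t : ℚ} {p : MvPolynomial ℕ ℚ}
    (hp : p ∈ weightSpace g t) (a : ℕ) : X 0 ^ a * p ∈ weightSpace g (t + 2 * a) := by
  induction a with
  | zero => simpa using hp
  | succ a ih =>
    convert X_zero_mul_mem_weightSpace ih using 1
    · push_cast; ring_nf
    · ring

lemma dopL_X_zero_pow_mul {g : ℕ} {t : ℚ} {p : MvPolynomial ℕ ℚ} (hp : p ∈ weightSpace g t)
    (a : ℕ) : dopL g (X 0 ^ (a + 1) * p) =
      X 0 ^ (a + 1) * dopL g p + (((a : ℚ) + 1) * (a + t)) • (X 0 ^ a * p) := by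
  induction a with
  | zero => simpa using dopL_X_zero_mul hp
  | succ a ih =>
    rw [pow_succ' _ (a + 1), mul_assoc, dopL_X_zero_mul (X_zero_pow_mul_mem_weightSpace hp _), ih,
      mul_add, mul_smul_comm, ← mul_assoc, ← pow_succ', ← mul_assoc, ← pow_succ', add_assoc,
      ← add_smul]
    congr 2
    push_cast
    ring

/-- The scalar by which `𝒟ᴺ⁻ᵃ m` occurs in `𝒟ᴺ (x₁ᵃ m)` modulo `x₁`, for `m` of weight `t`. -/
def loweringCoeff (N a : ℕ) (t : ℚ) : ℚ :=
  a.factorial * N.choose a * ∏ s ∈ Finset.range a, (t - N + a + s)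

lemma loweringCoeff_succ_succ (N a : ℕ) (t : ℚ) :
    loweringCoeff (N + 1) (a + 1) t =
      loweringCoeff N (a + 1) (t - 2) + ((a : ℚ) + 1) * (a + t) * loweringCoeff N a t := by
  have hch : ((N : ℚ) + 1) * N.choose a = (N.choose a + N.choose (a + 1)) * (a + 1) := by
    have := Nat.add_one_mul_choose_eq N a
    rw [Nat.choose_succ_succ] at this
    exact_mod_cast this
  have h1 : ∏ s ∈ Finset.range (a + 1), (t - (N + 1 : ℕ) + (a + 1 : ℕ) + s) =
      (∏ s ∈ Finset.range a, (t - N + a + s)) * (t - N + a + a) := by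
    rw [Finset.prod_range_succ]
    congr 1
    · exact Finset.prod_congr rfl fun s _ => by push_cast; ring
    · push_cast; ring
  have h2 : ∏ s ∈ Finset.range (a + 1), (t - 2 - N + (a + 1 : ℕ) + s) =
      (∏ s ∈ Finset.range a, (t - N + a + s)) * (t - N + a - 1) := by
    rw [Finset.prod_range_succ']
    congr 1
    · exact Finset.prod_congr rfl fun s _ => by push_cast; ring
    · push_cast; ring
  rw [loweringCoeff, loweringCoeff, loweringCoeff, h1, h2, Nat.choose_succ_succ,
    Nat.factorial_succ]
  push_cast
  linear_combination (-(a + 1) * a.factorial * ∏ s ∈ Finset.range a, (t - N + a + s) : ℚ) * hch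

lemma X_zero_mul_mem (p : MvPolynomial ℕ ℚ) :
    X 0 * p ∈ restrictSupport ℚ {d : ℕ →₀ ℕ | d 0 ≠ 0} := by
  rw [mem_restrictSupport_iff]
  intro d hd
  by_contra h
  simp only [Set.mem_ofPred_eq, not_not] at h
  refine mem_support_iff.mp hd ?_
  rw [coeff_X_mul', if_neg (by simp [h])]

lemma dopL_pow_X_zero_pow_mul_sub_mem {g : ℕ} (N a : ℕ) {t : ℚ} {p : MvPolynomial ℕ ℚ}
    (hp : p ∈ weightSpace g t) :
    (dopL g ^ N) (X 0 ^ a * p) - loweringCoeff N a t • (dopL g ^ (N - a)) p ∈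
      restrictSupport ℚ {d : ℕ →₀ ℕ | d 0 ≠ 0} := by
  induction N generalizing a t p with
  | zero =>
    cases a with
    | zero => simp [loweringCoeff]
    | succ a =>
      simpa [loweringCoeff, pow_succ', mul_assoc] using X_zero_mul_mem (X 0 ^ a * p)
  | succ N ih =>
    cases a with
    | zero => simp [loweringCoeff]
    | succ a =>
      have h1 := ih (a + 1) (dopL_mem_weightSpace hp)
      have h2 := Submodule.smul_mem _ (((a : ℚ) + 1) * (a + t)) (ih a hp)
      have h3 : loweringCoeff N (a + 1) (t - 2) • (dopL g ^ (N - (a + 1))) (dopL g p) =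
          loweringCoeff N (a + 1) (t - 2) • (dopL g ^ (N - a)) p := by
        by_cases h : a + 1 ≤ N
        · rw [← Module.End.mul_apply, ← pow_succ, show N - (a + 1) + 1 = N - a by omega]
        · simp [loweringCoeff, Nat.choose_eq_zero_of_lt (not_le.mp h)]
      rw [h3] at h1
      convert add_mem h1 h2 using 1
      rw [pow_succ, Module.End.mul_apply, dopL_X_zero_pow_mul hp, map_add, map_smul,
        Nat.add_sub_add_right, loweringCoeff_succ_succ]
      module

/-! ### The main theorem -/

lemma Mij_le_weightSpace (g c j : ℕ) : Mij c j ≤ weightSpace g (2 * c - j - g) := by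
  rw [Mij_eq]
  refine restrictSupport_mono _ ?_
  rintro d ⟨_, rfl, rfl⟩
  rfl

lemma Mij_eq_bot {i j : ℕ} (hj : 1 ≤ j) (hij : i ≤ j) : Mij i j = ⊥ := by
  rw [eq_bot_iff, Mij_eq, restrictSupport_le_iff]
  rintro d ⟨_, rfl, rfl⟩
  exact absurd (levelW_lt_codimW (by omega)) (not_lt.mpr hij)

lemma dopL_pow_mem_Mij (g n c j : ℕ) {p : MvPolynomial ℕ ℚ} (hp : p ∈ Mij (c + n) j) :
    (dopL g ^ n) p ∈ Mij c j := by
  rw [Mij_eq] at hp ⊢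
  refine dopL_pow_mem_restrictSupport g n ?_ hp
  rintro d ⟨h0, h1, h2⟩ e h1' h2' h0'
  exact ⟨h0' h0, by omega, by omega⟩

lemma loweringCoeff_eq_zero {g i j a : ℕ} (hji : j < i) (ha : i - j ≤ a) (hag : a ≤ g - i)
    (hig : i ≤ g) : loweringCoeff (g - i) a (2 * (g - a : ℕ) - j - g) = 0 := by
  rw [loweringCoeff, Finset.prod_eq_zero (i := a - (i - j)), mul_zero]
  · rw [Finset.mem_range]; omega
  · rw [Nat.cast_sub hig, Nat.cast_sub (by omega : a ≤ g), Nat.cast_sub ha, Nat.cast_sub hji.le]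
    ring

lemma loweringCoeff_ne_zero {g i j : ℕ} (hji : j < i) (hij : 2 * i ≤ g + j) :
    loweringCoeff (g - i) (i - j - 1) (2 * (g + j + 1 - i : ℕ) - j - g) ≠ 0 := by
  rw [loweringCoeff]
  refine mul_ne_zero (mul_ne_zero (by positivity) ?_) (Finset.prod_ne_zero_iff.mpr ?_)
  · exact_mod_cast (Nat.choose_pos (by omega)).ne'
  · intro s hs
    rw [Finset.mem_range] at hs
    obtain ⟨k, rfl⟩ : ∃ k, i = j + 1 + s + 1 + k := ⟨i - (j + 1 + s + 1), by omega⟩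
    obtain ⟨l, hl⟩ : ∃ l, g = (j + 1 + s + 1 + k) + l := ⟨g - (j + 1 + s + 1 + k), by omega⟩
    rw [show j + 1 + s + 1 + k - j - 1 = s + 1 + k by omega,
      show g - (j + 1 + s + 1 + k) = l by omega,
      show g + j + 1 - (j + 1 + s + 1 + k) = l + j + 1 by omega, hl]
    push_cast
    intro h
    have : (k : ℚ) + 1 = 0 := by linarith
    exact absurd this (by positivity)

lemma X_zero_pow_mul_monomial (a : ℕ) (d : ℕ →₀ ℕ) :
    X 0 ^ a * monomial d (1 : ℚ) = monomial (d + Finsupp.single 0 a) 1 := by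
  rw [X_pow_eq_monomial, monomial_mul, one_mul, add_comm]

/-- Every universal relation lies in the image of the primitive part, up to monomials other than
the `x₁`-free ones of codimension `i` and level `j`. -/
lemma Ipol_sup_PhiSub_le {g i j : ℕ} (hji : j < i) (hij : 2 * i ≤ g + j) :
    Ipol g ⊔ PhiSub (i - 1) j ≤
      (Mij (g + j + 1 - i) j).map (dopL g ^ (g + j + 1 - 2 * i)) ⊔
        restrictSupport ℚ {d | d 0 = 0 ∧ codimW d = i ∧ levelW d = j}ᶜ := by
  refine sup_le (sup_le ?_ (iSup_le fun n => ?_)) ?_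
  · refine le_sup_of_le_right (Submodule.span_le.mpr ?_)
    rintro _ ⟨d, hd, rfl⟩
    refine monomial_mem_restrictSupport_of_mem (fun h => ?_) _
    obtain ⟨_, h, _⟩ := h
    omega
  · rw [Submodule.span_le]
    rintro _ ⟨p, hp, rfl⟩
    rw [← dopL_pow_apply, SetLike.mem_coe, ← Submodule.mem_comap]
    rw [SetLike.mem_coe, Fil1Rg_eq] at hp
    refine restrictSupport_le_iff.mpr ?_ hp
    rintro d ⟨hd, -⟩
    rw [Submodule.mem_comap]
    by_cases hcase : levelW d = j ∧ i + n = g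
    swap
    · refine Submodule.mem_sup_right (dopL_pow_mem_restrictSupport g n (S := {d}) ?_
        (monomial_mem_restrictSupport_of_mem (Set.mem_singleton d) _))
      rintro _ rfl e h1 h2 - ⟨-, h3, h4⟩
      exact hcase ⟨by omega, by omega⟩
    obtain ⟨hl, hn⟩ := hcase
    obtain ⟨e, a, he0, rfl⟩ : ∃ e a, e 0 = 0 ∧ d = e + Finsupp.single 0 a :=
      ⟨d.erase 0, d 0, Finsupp.erase_same, eq_erase_zero_add d⟩
    simp only [codimW_add, levelW_add, codimW_single, levelW_single, zero_add, one_mul, zero_mul,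
      add_zero] at hd hl
    have hm : monomial e (1 : ℚ) ∈ Mij (g - a) j := by
      rw [Mij_eq]
      exact monomial_mem_restrictSupport_setOf ⟨he0, by omega, hl⟩ _
    rw [← X_zero_pow_mul_monomial]
    have key := dopL_pow_X_zero_pow_mul_sub_mem n a (Mij_le_weightSpace g _ _ hm)
    rw [← sub_add_cancel ((dopL g ^ n) _) (loweringCoeff n a _ • _)]
    refine add_mem (Submodule.mem_sup_right (restrictSupport_mono _ ?_ key))
      (Submodule.mem_sup_left ?_)
    · intro f hf h
      exact hf h.1
    obtain rfl : n = g - i := by omega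
    by_cases han : a ≤ g - i
    swap
    · simp [loweringCoeff, Nat.choose_eq_zero_of_lt (not_le.mp han)]
    by_cases ha : i - j ≤ a
    · simp [loweringCoeff_eq_zero hji ha han (by omega)]
    refine Submodule.smul_mem _ _ ⟨(dopL g ^ (i - j - 1 - a)) (monomial e 1), ?_, ?_⟩
    · refine dopL_pow_mem_Mij g _ _ _ ?_
      rwa [show g + j + 1 - i + (i - j - 1 - a) = g - a by omega]
    · rw [← Module.End.mul_apply, ← pow_add]
      congr 2
      omega
  · refine le_sup_of_le_right (Submodule.span_le.mpr ?_)
    rintro _ ⟨a, d, h0, hc, hl, rfl⟩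
    rw [X_zero_pow_mul_monomial]
    refine monomial_mem_restrictSupport_of_mem ?_ _
    rintro ⟨h0', hc', -⟩
    simp only [Finsupp.add_apply, Finsupp.single_eq_same, h0, zero_add] at h0'
    simp only [h0', Finsupp.single_zero, add_zero] at hc'
    omega

lemma mem_of_mem_sup_restrictSupport_compl {S : Set (ℕ →₀ ℕ)}
    {T : Submodule ℚ (MvPolynomial ℕ ℚ)} (hT : T ≤ restrictSupport ℚ S) {y : MvPolynomial ℕ ℚ}
    (hy : y ∈ restrictSupport ℚ S) (hyT : y ∈ T ⊔ restrictSupport ℚ Sᶜ) : y ∈ T := by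
  obtain ⟨u, hu, v, hv, rfl⟩ := Submodule.mem_sup.mp hyT
  have hvS : v ∈ restrictSupport ℚ S := by simpa using sub_mem hy (hT hu)
  have : v = 0 := by
    rw [← support_eq_empty, Finset.eq_empty_iff_forall_notMem]
    exact fun d hd => hv hd (hvS hd)
  simpa [this] using hu

lemma dopL_pow_mem_Ipol_sup_PhiSub {g i j : ℕ} (hj : 1 ≤ j) (hji : j < i) (hij : 2 * i ≤ g + j)
    {m : MvPolynomial ℕ ℚ} (hm : m ∈ Mij (g + j + 1 - i) j) :
    (dopL g ^ (g + j + 1 - 2 * i)) m ∈ Ipol g ⊔ PhiSub (i - 1) j := by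
  set C := loweringCoeff (g - i) (i - j - 1) (2 * (g + j + 1 - i : ℕ) - j - g) with hC
  have hC0 : C ≠ 0 := loweringCoeff_ne_zero hji hij
  have hfil : X 0 ^ (i - j - 1) * m ∈ restrictSupport ℚ {d | codimW d = g ∧ levelW d = j} := by
    suffices Mij (g + j + 1 - i) j ≤ (restrictSupport ℚ {d | codimW d = g ∧ levelW d = j}).comap
      (LinearMap.mulLeft ℚ (X 0 ^ (i - j - 1))) from this hm
    rw [Mij_eq, restrictSupport_le_iff]
    rintro d ⟨-, h1, h2⟩
    rw [Submodule.mem_comap, LinearMap.mulLeft_apply, X_zero_pow_mul_monomial]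
    refine monomial_mem_restrictSupport_setOf ⟨?_, ?_⟩ _
    · simp only [codimW_add, codimW_single]; omega
    · simp only [levelW_add, levelW_single]; omega
  have hI : (dopL g ^ (g - i)) (X 0 ^ (i - j - 1) * m) ∈ Ipol g := by
    rw [dopL_pow_apply]
    refine Submodule.mem_sup_right (Submodule.mem_iSup_of_mem (g - i) (Submodule.subset_span
      ⟨_, ?_, rfl⟩))
    rw [SetLike.mem_coe, Fil1Rg_eq]
    refine restrictSupport_mono _ ?_ hfil
    rintro d ⟨h1, h2⟩
    exact ⟨h1, by omega⟩
  have hZ := dopL_pow_X_zero_pow_mul_sub_mem (g - i) (i - j - 1) (Mij_le_weightSpace g _ _ hm)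
  rw [← hC, show g - i - (i - j - 1) = g + j + 1 - 2 * i by omega] at hZ
  have hR : (dopL g ^ (g - i)) (X 0 ^ (i - j - 1) * m) - C • (dopL g ^ (g + j + 1 - 2 * i)) m ∈
      restrictSupport ℚ {d | codimW d = i ∧ levelW d = j} := by
    refine sub_mem (dopL_pow_mem_restrictSupport g _ ?_ hfil) (Submodule.smul_mem _ _ ?_)
    · rintro d ⟨h1, h2⟩ e h1' h2' -
      exact ⟨by omega, by omega⟩
    · rw [Mij_eq] at hm
      refine dopL_pow_mem_restrictSupport g _ ?_ hm
      rintro d ⟨-, h1, h2⟩ e h1' h2' -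
      exact ⟨by omega, by omega⟩
  have hPhi : (dopL g ^ (g - i)) (X 0 ^ (i - j - 1) * m) -
      C • (dopL g ^ (g + j + 1 - 2 * i)) m ∈ PhiSub (i - 1) j := by
    suffices restrictSupport ℚ ({d | d 0 ≠ 0} ∩ {d | codimW d = i ∧ levelW d = j}) ≤
      PhiSub (i - 1) j from this fun d hd => ⟨hZ hd, hR hd⟩
    rw [restrictSupport_le_iff]
    rintro d ⟨h0, h1, h2⟩
    rw [eq_erase_zero_add d, codimW_add, codimW_single] at h1
    rw [eq_erase_zero_add d, levelW_add, levelW_single] at h2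
    simp only [Set.mem_ofPred_eq] at h0
    refine Submodule.subset_span ⟨d 0, d.erase 0, Finsupp.erase_same, by omega, by omega, ?_⟩
    rw [X_zero_pow_mul_monomial, ← eq_erase_zero_add]
  rw [← Submodule.smul_mem_iff _ hC0]
  convert sub_mem (Submodule.mem_sup_left hI) (Submodule.mem_sup_right hPhi) using 1
  rw [sub_sub_cancel]

/-- let `j ≥ 1` and `2i − j ≤ g`.  For every `y ∈ M^i_{(j)}` one has
`y ∈ I + Φ_{i−1}` if and only if `y ∈ 𝒟^{g−2i+j+1}(M^{g−i+j+1}_{(j)})`. -/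
theorem stmt17 (g : ℕ) (hg : 3 ≤ g) (i j : ℕ) (hj : 1 ≤ j) (hij : 2 * i ≤ g + j) :
    ∀ y ∈ Mij i j,
      (y ∈ Ipol g ⊔ PhiSub (i - 1) j ↔
        y ∈ (Dop g)^[g + j + 1 - 2 * i] '' (Mij (g + j + 1 - i) j : Set (MvPolynomial ℕ ℚ))) := by
  intro y hy
  rcases le_or_gt i j with hle | hji
  · rw [Mij_eq_bot hj hle, Submodule.mem_bot] at hy
    subst hy
    refine iff_of_true (zero_mem _) ⟨0, zero_mem _, ?_⟩
    rw [← dopL_pow_apply, map_zero]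
  · constructor
    · intro h
      have hT : (Mij (g + j + 1 - i) j).map (dopL g ^ (g + j + 1 - 2 * i)) ≤
          restrictSupport ℚ {d | d 0 = 0 ∧ codimW d = i ∧ levelW d = j} := by
        rw [Submodule.map_le_iff_le_comap, ← Mij_eq]
        intro m hm
        refine dopL_pow_mem_Mij g _ _ _ ?_
        rwa [show i + (g + j + 1 - 2 * i) = g + j + 1 - i by omega]
      obtain ⟨m, hm, rfl⟩ := mem_of_mem_sup_restrictSupport_compl hT (Mij_eq i j ▸ hy)
        (Ipol_sup_PhiSub_le hji hij h)
      exact ⟨m, hm, (dopL_pow_apply g _ m).symm⟩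
    · rintro ⟨m, hm, rfl⟩
      rw [← dopL_pow_apply]
      exact dopL_pow_mem_Ipol_sup_PhiSub hj hji hij hm
end
end
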